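/- Let s ∈ ℝ^n satisfy m(s) ≤ m(0) and ‖g_s‖_{N,1} ≥ (1/2) σ N(s)², where g_s := g + Hs. Let d ∈ ℝ^n satisfy N(d) = 1 and ⟨g_s, d⟩ = −‖g_s‖_{N,1} (i.e. d minimizes ⟨g_s, v⟩ over N(v) = 1). Then there exists α ≥ 0 such that m(s) − m(s + α d) ≥ (1/2) · min[ ( ‖g_s‖_{N,1} − (1/2)σN(s)² )² / (1 + (3/2)(‖H‖_{N,2} + σ N(s))), ( ‖g_s‖_{N,1} − (1/2)σN(s)² )^{3/2} / (3√σ) ]. -/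

import Mathlib

open scoped RealInnerProductSpace

noncomputable section

/-- Abbreviation for the Euclidean space `ℝ^n`. -/
abbrev E (n : ℕ) := EuclideanSpace ℝ (Fin n)

/-- `N` is a norm on `ℝ^n` (possibly non-smooth, e.g. `ℓ¹` or `ℓ∞`). -/
structure IsNorm (n : ℕ) (N : E n → ℝ) : Prop where
  add_le : ∀ x y, N (x + y) ≤ N x + N y
  smul : ∀ (c : ℝ) (x : E n), N (c • x) = |c| * N x
  eq_zero : ∀ x, N x = 0 → x = 0

/-- The dual norm `‖v‖_{N,1} := max_{N s = 1} ⟪v, s⟫`. -/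
def dualNorm (n : ℕ) (N : E n → ℝ) (v : E n) : ℝ :=
  sSup {t : ℝ | ∃ s, N s = 1 ∧ t = ⟪v, s⟫}

/-- The smallest eigenvalue of a symmetric operator `A`, as the infimum of the
Rayleigh quotient over the Euclidean unit sphere. -/
def lamMin (n : ℕ) (A : E n →L[ℝ] E n) : ℝ :=
  sInf {t : ℝ | ∃ v : E n, ‖v‖ = 1 ∧ t = ⟪A v, v⟫}

/-- The norm `‖H‖_{N,2} := max_{N s = 1} |⟪H s, s⟫|` of a symmetric operator induced by `N`. -/
def matNormN (n : ℕ) (N : E n → ℝ) (A : E n →L[ℝ] E n) : ℝ :=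
  sSup {t : ℝ | ∃ v : E n, N v = 1 ∧ t = |⟪A v, v⟫|}

/-- The regularized quadratic model
`m(s) = f₀ + ⟪g,s⟫ + (1/2)⟪Hs,s⟫ + (σ/6) N(s)³`. -/
def qm (n : ℕ) (N : E n → ℝ) (f0 : ℝ) (g : E n) (H : E n →L[ℝ] E n) (σ : ℝ)
    (s : E n) : ℝ :=
  f0 + ⟪g, s⟫ + (1 / 2) * ⟪H s, s⟫ + σ / 6 * N s ^ 3

theorem IsNorm.nonneg {n : ℕ} {N : E n → ℝ} (hN : IsNorm n N) (x : E n) : 0 ≤ N x := by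
  have h0 : N 0 = 0 := by simpa using hN.smul 0 0
  have hneg : N (-x) = N x := by simpa using hN.smul (-1) x
  have h := hN.add_le x (-x)
  rw [add_neg_cancel, h0, hneg] at h
  linarith

theorem IsNorm.continuous {n : ℕ} {N : E n → ℝ} (hN : IsNorm n N) : Continuous N := by
  have hconv : ConvexOn ℝ Set.univ N := by
    refine ⟨convex_univ, fun x _ y _ a b ha hb _ => ?_⟩
    calc N (a • x + b • y) ≤ N (a • x) + N (b • y) := hN.add_le _ _
      _ = a • N x + b • N y := by
        rw [hN.smul, hN.smul, abs_of_nonneg ha, abs_of_nonneg hb, smul_eq_mul, smul_eq_mul]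
  exact continuousOn_univ.1 (hconv.continuousOn isOpen_univ)

/-- Every norm on `ℝ^n` dominates a positive multiple of the Euclidean norm. -/
theorem IsNorm.exists_pos_mul_norm_le {n : ℕ} {N : E n → ℝ} (hN : IsNorm n N) :
    ∃ c : ℝ, 0 < c ∧ ∀ x, c * ‖x‖ ≤ N x := by
  rcases (Metric.sphere (0 : E n) 1).eq_empty_or_nonempty with he | hne
  · refine ⟨1, one_pos, fun x => ?_⟩
    rcases eq_or_ne x 0 with rfl | hx
    · simpa using hN.nonneg 0
    · have : ‖x‖⁻¹ • x ∈ Metric.sphere (0 : E n) 1 := by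
        simp [norm_smul, hx]
      simp [he] at this
  · obtain ⟨z, hz, hmin⟩ := (isCompact_sphere (0 : E n) 1).exists_isMinOn hne
      hN.continuous.continuousOn
    have hz0 : z ≠ 0 := by
      rintro rfl
      simp at hz
    refine ⟨N z, lt_of_le_of_ne (hN.nonneg z) fun h => hz0 (hN.eq_zero z h.symm), fun x => ?_⟩
    rcases eq_or_ne x 0 with rfl | hx
    · simpa using hN.nonneg 0
    · have hmem : ‖x‖⁻¹ • x ∈ Metric.sphere (0 : E n) 1 := by
        simp [norm_smul, hx]
      have h : N z ≤ N (‖x‖⁻¹ • x) := hmin hmem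
      have hpos : 0 < ‖x‖ := norm_pos_iff.2 hx
      rw [hN.smul, abs_of_nonneg (inv_nonneg.2 hpos.le), inv_mul_eq_div, le_div_iff₀ hpos] at h
      exact h

theorem abs_inner_le_matNormN {n : ℕ} {N : E n → ℝ} (hN : IsNorm n N) (A : E n →L[ℝ] E n)
    {v : E n} (hv : N v = 1) : |⟪A v, v⟫| ≤ matNormN n N A := by
  obtain ⟨c, hc, hle⟩ := hN.exists_pos_mul_norm_le
  refine le_csSup ⟨‖A‖ * c⁻¹ * c⁻¹, ?_⟩ ⟨v, hv, rfl⟩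
  rintro t ⟨w, hw, rfl⟩
  have hw' : ‖w‖ ≤ c⁻¹ := by
    rw [← one_div, le_div_iff₀ hc, mul_comm, ← hw]
    exact hle w
  calc |⟪A w, w⟫| ≤ ‖A w‖ * ‖w‖ := abs_real_inner_le_norm _ _
    _ ≤ (‖A‖ * c⁻¹) * c⁻¹ := by
      gcongr
      exact (A.le_opNorm w).trans (by gcongr)

theorem qm_add_smul_le {n : ℕ} {N : E n → ℝ} (hN : IsNorm n N) (f0 : ℝ) (g : E n)
    (H : E n →L[ℝ] E n) (hH : ∀ x y : E n, ⟪H x, y⟫ = ⟪x, H y⟫) {σ : ℝ} (hσ : 0 ≤ σ)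
    (s : E n) {d : E n} (hd : N d = 1) {α : ℝ} (hα : 0 ≤ α) :
    qm n N f0 g H σ (s + α • d) ≤ qm n N f0 g H σ s + α * (⟪g + H s, d⟫ + 1 / 2 * σ * N s ^ 2)
      + α ^ 2 / 2 * (matNormN n N H + σ * N s) + σ / 6 * α ^ 3 := by
  have hN1 : N (s + α • d) ≤ N s + α := by
    simpa [hN.smul, hd, abs_of_nonneg hα] using hN.add_le s (α • d)
  have hcube : σ / 6 * N (s + α • d) ^ 3 ≤ σ / 6 * (N s + α) ^ 3 := by
    have := hN.nonneg (s + α • d)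
    gcongr
  have hcurv : α ^ 2 / 2 * ⟪H d, d⟫ ≤ α ^ 2 / 2 * matNormN n N H := by
    gcongr
    exact (le_abs_self _).trans (abs_inner_le_matNormN hN H hd)
  have hsym : ⟪H d, s⟫ = ⟪H s, d⟫ := by rw [hH d s, real_inner_comm]
  simp only [qm, map_add, map_smul, inner_add_left, inner_add_right, real_inner_smul_left,
    real_inner_smul_right, hsym]
  linarith

theorem exists_cubic_decrease {G B σ : ℝ} (hG : 0 ≤ G) (hB : 0 ≤ B) (hσ : 0 < σ) :
    ∃ α : ℝ, 0 ≤ α ∧ 1 / 2 * min (G ^ 2 / (1 + 3 / 2 * B)) (G ^ ((3 : ℝ) / 2) / (3 * √σ)) ≤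
      α * G - α ^ 2 / 2 * B - σ / 6 * α ^ 3 := by
  have hK : 0 < 1 + 3 / 2 * B := by positivity
  set α := min (G / (1 + 3 / 2 * B)) √(G / σ) with hαdef
  have hα : 0 ≤ α := le_min (by positivity) (by positivity)
  have h1 : α * (1 + 3 / 2 * B) ≤ G := (le_div_iff₀ hK).1 (min_le_left _ _)
  have h2 : α ^ 2 * σ ≤ G := by
    rw [← le_div_iff₀ hσ, ← Real.sq_sqrt (show 0 ≤ G / σ by positivity)]
    exact pow_le_pow_left₀ hα (min_le_right _ _) 2
  have hmin : min (G ^ 2 / (1 + 3 / 2 * B)) (G ^ ((3 : ℝ) / 2) / (3 * √σ)) ≤ α * G := by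
    have hpow : G ^ ((3 : ℝ) / 2) = G * √G := by
      rw [Real.sqrt_eq_rpow, show (3 : ℝ) / 2 = 1 + 1 / 2 by norm_num,
        Real.rpow_add_of_nonneg hG zero_le_one (by norm_num), Real.rpow_one]
    rw [hαdef, min_mul_of_nonneg _ _ hG]
    refine min_le_min (le_of_eq (by ring)) ?_
    rw [hpow, Real.sqrt_div hG, div_mul_eq_mul_div, mul_comm (√G)]
    have : 0 < √σ := Real.sqrt_pos.2 hσ
    gcongr
    linarith
  refine ⟨α, hα, ?_⟩
  have h3 : α * (α * (1 + 3 / 2 * B)) ≤ α * G := mul_le_mul_of_nonneg_left h1 hα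
  have h4 : α * (α ^ 2 * σ) ≤ α * G := mul_le_mul_of_nonneg_left h2 hα
  nlinarith [sq_nonneg α]

/-- Cauchy-point decrease: if `m(s) ≤ m(0)`,
`‖g+Hs‖_{N,1} ≥ (1/2)σN(s)²`, and `d` is a steepest-descent direction for `g+Hs`
in the norm `N`, then some `α ≥ 0` gives the stated model decrease. -/
theorem stmt14 {n : ℕ} (hn : 1 ≤ n) (N : E n → ℝ) (hN : IsNorm n N)
    (f0 : ℝ) (g : E n) (H : E n →L[ℝ] E n)
    (hH : ∀ x y : E n, ⟪H x, y⟫ = ⟪x, H y⟫)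
    (σ : ℝ) (hσ : 0 < σ) (s d : E n)
    (hdesc : qm n N f0 g H σ s ≤ qm n N f0 g H σ 0)
    (hbig : (1 / 2) * σ * N s ^ 2 ≤ dualNorm n N (g + H s))
    (hd1 : N d = 1) (hd2 : ⟪g + H s, d⟫ = -dualNorm n N (g + H s)) :
    ∃ α : ℝ, 0 ≤ α ∧
      qm n N f0 g H σ s - qm n N f0 g H σ (s + α • d) ≥
        (1 / 2) *
          min ((dualNorm n N (g + H s) - (1 / 2) * σ * N s ^ 2) ^ 2 /
              (1 + (3 / 2) * (matNormN n N H + σ * N s)))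
            ((dualNorm n N (g + H s) - (1 / 2) * σ * N s ^ 2) ^ ((3 : ℝ) / 2) /
              (3 * Real.sqrt σ)) := by
  have hM : 0 ≤ matNormN n N H := (abs_nonneg _).trans (abs_inner_le_matNormN hN H hd1)
  have hs := hN.nonneg s
  obtain ⟨α, hα, hdec⟩ := exists_cubic_decrease (sub_nonneg.2 hbig)
    (show 0 ≤ matNormN n N H + σ * N s by positivity) hσ
  have hle := qm_add_smul_le hN f0 g H hH hσ.le s hd1 hα
  rw [hd2] at hle
  exact ⟨α, hα, by linarith⟩
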